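/- Let E be a real inner product space, let α, β > 0, and let f : E → ℝ be differentiable, α-strongly convex on E (i.e. x ↦ f(x) − (α/2)‖x‖² is convex), with β-Lipschitz gradient ∇f and global minimizer x*. Let 0 < η ≤ 1/(5β), and let (x_k)_{k∈ℕ} and (ĝ_k)_{k∈ℕ} be sequences in E with x_{k+1} = x_k − η·ĝ_k and ‖ĝ_k − ∇f(x_k)‖ ≤ (2/3)‖∇f(x_k)‖ for every k. Then for every k ∈ ℕ, ‖∇f(x_k)‖² ≤ 2β(1 − αη/9)^k · (f(x_0) − f(x*)). -/

import Mathlib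

open scoped InnerProductSpace

section GradientLemmas

variable {E : Type*} [NormedAddCommGroup E] [InnerProductSpace ℝ E] [CompleteSpace E]

/-- The derivative of a differentiable function along a line, in terms of the gradient. -/
lemma Differentiable.hasDerivAt_comp_line {f : E → ℝ} (hf : Differentiable ℝ f) (x v : E)
    (t : ℝ) : HasDerivAt (fun s : ℝ => f (x + s • v)) ⟪gradient f (x + t • v), v⟫_ℝ t := by
  have hline : HasDerivAt (fun s : ℝ => x + s • v) v t := by
    simpa using ((hasDerivAt_id t).smul_const v).const_add x
  have := (hf (x + t • v)).hasGradientAt.hasFDerivAt.comp_hasDerivAt t hline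
  simpa [Function.comp_def] using this

/-- The quadratic upper bound for functions with Lipschitz gradient. -/
lemma Differentiable.le_add_inner_gradient_add_sq {f : E → ℝ} (hf : Differentiable ℝ f) {β : ℝ}
    (hlip : ∀ x y : E, ‖gradient f x - gradient f y‖ ≤ β * ‖x - y‖) (x v : E) :
    f (x + v) ≤ f x + ⟪gradient f x, v⟫_ℝ + β / 2 * ‖v‖ ^ 2 := by
  let φ : ℝ → ℝ := fun t => f (x + t • v) - t * ⟪gradient f x, v⟫_ℝ - t ^ 2 * (β / 2 * ‖v‖ ^ 2)
  have hφ (t : ℝ) : HasDerivAt φ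
      (⟪gradient f (x + t • v), v⟫_ℝ - ⟪gradient f x, v⟫_ℝ - 2 * t * (β / 2 * ‖v‖ ^ 2)) t := by
    have h := ((hf.hasDerivAt_comp_line x v t).fun_sub
      ((hasDerivAt_id' t).mul_const ⟪gradient f x, v⟫_ℝ)).fun_sub
      ((hasDerivAt_pow 2 t).mul_const (β / 2 * ‖v‖ ^ 2))
    exact h.congr_deriv (by simp)
  have hanti : AntitoneOn φ (Set.Icc 0 1) := by
    refine antitoneOn_of_deriv_nonpos (convex_Icc 0 1)
      (fun t _ => (hφ t).continuousAt.continuousWithinAt)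
      (fun t _ => (hφ t).differentiableAt.differentiableWithinAt) fun t ht => ?_
    rw [interior_Icc] at ht
    rw [(hφ t).deriv, ← inner_sub_left]
    have hL := hlip (x + t • v) x
    rw [add_sub_cancel_left, norm_smul, Real.norm_of_nonneg ht.1.le] at hL
    have hcs := real_inner_le_norm (gradient f (x + t • v) - gradient f x) v
    nlinarith [mul_le_mul_of_nonneg_right hL (norm_nonneg v)]
  have h := hanti (Set.left_mem_Icc.2 zero_le_one) (Set.right_mem_Icc.2 zero_le_one) zero_le_one
  simp only [φ, one_smul, zero_smul, add_zero] at h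
  linarith

/-- The quadratic lower bound for differentiable strongly convex functions. -/
lemma StrongConvexOn.add_inner_gradient_add_sq_le {f : E → ℝ} {α : ℝ}
    (hsc : StrongConvexOn Set.univ α f) (hf : Differentiable ℝ f) (x v : E) :
    f x + ⟪gradient f x, v⟫_ℝ + α / 2 * ‖v‖ ^ 2 ≤ f (x + v) := by
  let ψ : ℝ → ℝ := fun t => f (x + t • v) - α / 2 * ‖x + t • v‖ ^ 2
  have hψ : ConvexOn ℝ Set.univ ψ := by
    have h := (strongConvexOn_iff_convex.1 hsc).comp_affineMap (AffineMap.lineMap x (x + v))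
    simpa [ψ, Function.comp_def, AffineMap.lineMap_apply, add_comm] using h
  have hderiv : HasDerivAt ψ (⟪gradient f x, v⟫_ℝ - α * ⟪x, v⟫_ℝ) 0 := by
    have hline : HasDerivAt (fun s : ℝ => x + s • v) v 0 := by
      simpa using ((hasDerivAt_id (0 : ℝ)).smul_const v).const_add x
    have h := (hf.hasDerivAt_comp_line x v 0).fun_sub (hline.norm_sq.const_mul (α / 2))
    simp only [zero_smul, add_zero] at h
    exact h.congr_deriv (by ring)
  have h := hψ.le_slope_of_hasDerivAt (Set.mem_univ 0) (Set.mem_univ 1) zero_lt_one hderiv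
  simp only [slope_def_field, ψ, one_smul, zero_smul, add_zero, sub_zero, div_one] at h
  rw [norm_add_sq_real] at h
  linarith

/-- The Polyak–Łojasiewicz inequality for strongly convex functions. -/
lemma StrongConvexOn.two_mul_sub_le_norm_gradient_sq {f : E → ℝ} {α : ℝ} (hα : 0 < α)
    (hsc : StrongConvexOn Set.univ α f) (hf : Differentiable ℝ f) (x y : E) :
    2 * α * (f x - f y) ≤ ‖gradient f x‖ ^ 2 := by
  have h := hsc.add_inner_gradient_add_sq_le hf x (y - x)
  rw [add_sub_cancel] at h
  have hsq := norm_add_sq_real (gradient f x) (α • (y - x))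
  rw [inner_smul_right, norm_smul, Real.norm_of_nonneg hα.le] at hsq
  nlinarith [sq_nonneg ‖gradient f x + α • (y - x)‖, mul_le_mul_of_nonneg_left h hα.le]

/-- The squared gradient is controlled by the gap to a lower bound of the function. -/
lemma Differentiable.norm_gradient_sq_le {f : E → ℝ} (hf : Differentiable ℝ f) {β : ℝ}
    (hβ : 0 < β) (hlip : ∀ x y : E, ‖gradient f x - gradient f y‖ ≤ β * ‖x - y‖) {m : ℝ}
    (hm : ∀ x, m ≤ f x) (x : E) : ‖gradient f x‖ ^ 2 ≤ 2 * β * (f x - m) := by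
  have h := (hm _).trans (hf.le_add_inner_gradient_add_sq hlip x (-(β⁻¹ • gradient f x)))
  rw [inner_neg_right, inner_smul_right, real_inner_self_eq_norm_sq, norm_neg, norm_smul,
    Real.norm_of_nonneg (inv_pos.2 hβ).le] at h
  have h' := mul_le_mul_of_nonneg_left h (mul_pos two_pos hβ).le
  field_simp at h'
  linarith

/-- One step of gradient descent with relative gradient error at most `2 / 3` decreases the
function by a multiple of the squared gradient. -/
lemma Differentiable.inexact_gradient_step_le {f : E → ℝ} (hf : Differentiable ℝ f) {β η : ℝ}
    (hlip : ∀ x y : E, ‖gradient f x - gradient f y‖ ≤ β * ‖x - y‖) (hη : 0 ≤ η)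
    (hβη : β * η ≤ 1) {x g : E} (hg : ‖g - gradient f x‖ ≤ 2 / 3 * ‖gradient f x‖) :
    f (x - η • g) ≤ f x - 5 * η / 18 * ‖gradient f x‖ ^ 2 := by
  have h := hf.le_add_inner_gradient_add_sq hlip x (-(η • g))
  rw [← sub_eq_add_neg, inner_neg_right, inner_smul_right, norm_neg, norm_smul,
    Real.norm_of_nonneg hη] at h
  have hsq := norm_sub_sq_real g (gradient f x)
  rw [real_inner_comm] at hsq
  have herr : ‖g - gradient f x‖ ^ 2 ≤ (2 / 3 * ‖gradient f x‖) ^ 2 := by gcongr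
  have hinner : η * (5 / 9 * ‖gradient f x‖ ^ 2 + ‖g‖ ^ 2) ≤ η * (2 * ⟪gradient f x, g⟫_ℝ) :=
    mul_le_mul_of_nonneg_left (by linarith) hη
  have hstep : β * η * (η * ‖g‖ ^ 2) ≤ 1 * (η * ‖g‖ ^ 2) := by gcongr
  linarith

end GradientLemmas

/-- Exponential decay of gradient magnitudes along CEAL iterates: if
`x (k+1) = x k - η • ĝ k` with approximate gradients `‖ĝ k - ∇f (x k)‖ ≤ (2/3)‖∇f (x k)‖`
and `0 < η ≤ 1/(5β)`, then `‖∇f (x k)‖² ≤ 2β (1 - αη/9)^k (f (x 0) - f xstar)`. -/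
theorem iterates_gradient_decay {E : Type*} [NormedAddCommGroup E]
    [InnerProductSpace ℝ E] [CompleteSpace E] (α β : ℝ) (hα : 0 < α) (hβ : 0 < β)
    (f : E → ℝ) (hf : Differentiable ℝ f) (hsc : StrongConvexOn Set.univ α f)
    (hlip : ∀ x y : E, ‖gradient f x - gradient f y‖ ≤ β * ‖x - y‖)
    (xstar : E) (hxstar : ∀ x, f xstar ≤ f x)
    (η : ℝ) (hη : 0 < η) (hη' : η ≤ 1 / (5 * β))
    (x ghat : ℕ → E) (hstep : ∀ k, x (k + 1) = x k - η • ghat k)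
    (hg : ∀ k, ‖ghat k - gradient f (x k)‖ ≤ 2 / 3 * ‖gradient f (x k)‖) :
    ∀ k : ℕ, ‖gradient f (x k)‖ ^ 2 ≤ 2 * β * (1 - α * η / 9) ^ k * (f (x 0) - f xstar) := by
  have hβη : β * η ≤ 1 := by
    rw [le_div_iff₀ (by positivity)] at hη'
    nlinarith [mul_pos hβ hη]
  have hgap (k : ℕ) : 0 ≤ f (x k) - f xstar := sub_nonneg.2 (hxstar _)
  have hcontr (k : ℕ) :
      f (x (k + 1)) - f xstar ≤ (1 - α * η / 9) * (f (x k) - f xstar) := by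
    have hdec := hf.inexact_gradient_step_le hlip hη.le hβη (hg k)
    rw [← hstep] at hdec
    have hPL := hsc.two_mul_sub_le_norm_gradient_sq hα hf (x k) xstar
    nlinarith [mul_le_mul_of_nonneg_left hPL hη.le, mul_nonneg (mul_pos hα hη).le (hgap k)]
  have hdecay (k : ℕ) : f (x k) - f xstar ≤ (1 - α * η / 9) ^ k * (f (x 0) - f xstar) := by
    rcases le_or_gt 0 (1 - α * η / 9) with hc | hc
    · induction k with
      | zero => simp
      | succ k ih =>
        rw [pow_succ', mul_assoc]
        exact (hcontr k).trans (mul_le_mul_of_nonneg_left ih hc)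
    -- A negative contraction factor forces all gaps to vanish.
    · have hzero (j : ℕ) : f (x j) - f xstar = 0 := by
        nlinarith [hgap j, hgap (j + 1), hcontr j]
      simp [hzero]
  intro k
  rw [mul_assoc]
  exact (hf.norm_gradient_sq_le hβ hlip hxstar (x k)).trans
    (mul_le_mul_of_nonneg_left (hdecay k) (by positivity))
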